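/- arXiv:2603.03829 — 2 statements merged into one kernel-verified Lean document; each statement's English description precedes it below -/
import Mathlib

section
/- E(3,(0,0,0)) = 1, and for every n ≥ 3 and every d ∈ ℕⁿ, E(n+1,(d₁,…,d_n,0)) = β·E(n,d) + Σ_{i=1}^n E(n, d − eᵢ), where a summand with dᵢ = 0 is interpreted as 0. (This is the K-theoretic string equation for the twisted psi-classes Ψᵢ = [Lᵢ]ψᵢ on M̄_{0,n} together with its closed-form solution ∫_{M̄_{0,n}} Ψ^d = β^{n−3−|d|}·(n−3 choose n−3−|d|, d₁,…,d_n).) -/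
/-- The genus-zero twisted psi-class intersection numbers on `M̄_{0,n}` in `K`-theory,
as elements of `ℤ[β]`:
`E(n, d) = β^(n-3-|d|) · (n-3 choose n-3-|d|, d₁, …, d_n)` if `|d| ≤ n - 3` and `0`
otherwise; equivalently, `E(n, d)` is the coefficient of `t₁^{d₁} ⋯ t_n^{d_n}` in
`(β + t₁ + ⋯ + t_n)^{n-3}`.  Here `β` is the indeterminate `Polynomial.X : ℤ[β]`. -/
noncomputable def kE (n : ℕ) (d : Fin n → ℕ) : Polynomial ℤ :=
  if (∑ i, d i) ≤ n - 3 then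
    (Nat.multinomial Finset.univ (Fin.snoc d (n - 3 - ∑ i, d i)) : Polynomial ℤ) *
      Polynomial.X ^ (n - 3 - ∑ i, d i)
  else 0

open Finset in
theorem Nat.multinomial_univ_eq_sum_update {ι : Type*} [Fintype ι] [DecidableEq ι]
    (f : ι → ℕ) (hf : ∑ i, f i ≠ 0) :
    Nat.multinomial univ f =
      ∑ i, if f i = 0 then 0 else Nat.multinomial univ (Function.update f i (f i - 1)) := by
  have hpos : 0 < ∏ i, (f i).factorial := prod_pos fun i _ => Nat.factorial_pos _
  refine Nat.eq_of_mul_eq_mul_left hpos ?_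
  rw [Nat.multinomial_spec, mul_sum, ← Nat.mul_factorial_pred hf, sum_mul]
  refine sum_congr rfl fun i _ => ?_
  split_ifs with hi
  · simp [hi]
  · have hsum : ∑ j, Function.update f i (f i - 1) j = ∑ j, f j - 1 := by
      rw [sum_update_of_mem (mem_univ i), ← add_sum_erase univ f (mem_univ i),
        sdiff_singleton_eq_erase]
      omega
    have hprod : ∏ j, (f j).factorial =
        f i * ∏ j, (Function.update f i (f i - 1) j).factorial := by
      rw [← mul_prod_erase univ _ (mem_univ i),
        ← mul_prod_erase univ (fun j => (Function.update f i (f i - 1) j).factorial) (mem_univ i),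
        Function.update_self, ← mul_assoc, Nat.mul_factorial_pred hi]
      congr 1
      refine prod_congr rfl fun j hj => ?_
      rw [Function.update_of_ne (ne_of_mem_erase hj)]
    rw [hprod, mul_assoc, Nat.multinomial_spec, hsum]

theorem Nat.multinomial_univ_snoc_snoc_zero {n : ℕ} (d : Fin n → ℕ) (c : ℕ) :
    Nat.multinomial Finset.univ (Fin.snoc (Fin.snoc d 0 : Fin (n + 1) → ℕ) c :
      Fin (n + 2) → ℕ) =
    Nat.multinomial Finset.univ (Fin.snoc d c : Fin (n + 1) → ℕ) := by
  simp [Nat.multinomial, Fin.sum_univ_castSucc, Fin.prod_univ_castSucc]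

theorem Nat.multinomial_univ_snoc_eq_sum {n : ℕ} (d : Fin n → ℕ) (c : ℕ)
    (h : ∑ i, d i + c ≠ 0) :
    Nat.multinomial Finset.univ (Fin.snoc d c : Fin (n + 1) → ℕ) =
      (if c = 0 then 0 else
        Nat.multinomial Finset.univ (Fin.snoc d (c - 1) : Fin (n + 1) → ℕ)) +
      ∑ i, if d i = 0 then 0 else Nat.multinomial Finset.univ
        (Fin.snoc (Function.update d i (d i - 1)) c : Fin (n + 1) → ℕ) := by
  rw [Nat.multinomial_univ_eq_sum_update _ (by simpa [Fin.sum_univ_castSucc] using h),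
    Fin.sum_univ_castSucc, add_comm]
  simp only [Fin.snoc_castSucc, Fin.snoc_last, Fin.update_snoc_last, Fin.snoc_update]

theorem sum_update_pred {n : ℕ} (d : Fin n → ℕ) (i : Fin n) (hi : d i ≠ 0) :
    ∑ j, Function.update d i (d i - 1) j + 1 = ∑ j, d j := by
  rw [Finset.sum_update_of_mem (Finset.mem_univ i),
    ← Finset.add_sum_erase Finset.univ d (Finset.mem_univ i), Finset.sdiff_singleton_eq_erase]
  omega

/-- `E(3,(0,0,0)) = 1`, and for every `n ≥ 3` and `d ∈ ℕⁿ`,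
`E(n+1, (d₁,…,d_n,0)) = β·E(n,d) + Σ_{i=1}^n E(n, d - eᵢ)` (summands with `dᵢ = 0` read
as `0`): the `K`-theoretic string equation and its closed-form solution. -/
theorem ktheory_string_equation :
    kE 3 (fun _ => 0) = 1 ∧
    ∀ n : ℕ, 3 ≤ n → ∀ d : Fin n → ℕ,
      kE (n + 1) (Fin.snoc d 0) =
        Polynomial.X * kE n d +
        ∑ i : Fin n,
          if d i = 0 then 0 else kE n (Function.update d i (d i - 1)) := by
  constructor
  · simp [kE, Nat.multinomial, Fin.sum_univ_castSucc, Fin.prod_univ_castSucc,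
      Nat.div_self (Nat.factorial_pos _)]
  intro n hn d
  have hs : ∑ i, (Fin.snoc d 0 : Fin (n + 1) → ℕ) i = ∑ i, d i := by
    simp [Fin.sum_univ_castSucc]
  by_cases h : ∑ i, d i ≤ n + 1 - 3
  · have hterm : ∀ i, (if d i = 0 then 0 else kE n (Function.update d i (d i - 1))) =
        ((if d i = 0 then 0 else Nat.multinomial Finset.univ
          (Fin.snoc (Function.update d i (d i - 1)) (n + 1 - 3 - ∑ i, d i) :
            Fin (n + 1) → ℕ) : ℕ) : Polynomial ℤ) *
          Polynomial.X ^ (n + 1 - 3 - ∑ i, d i) := by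
      intro i
      split_ifs with hi
      · simp
      · have hu := sum_update_pred d i hi
        have he : n - 3 - ∑ j, Function.update d i (d i - 1) j = n + 1 - 3 - ∑ j, d j := by
          omega
        rw [kE, if_pos (by omega), he]
    have hlast : Polynomial.X * kE n d =
        ((if n + 1 - 3 - ∑ i, d i = 0 then 0 else Nat.multinomial Finset.univ
          (Fin.snoc d (n + 1 - 3 - ∑ i, d i - 1) : Fin (n + 1) → ℕ) : ℕ) : Polynomial ℤ) *
          Polynomial.X ^ (n + 1 - 3 - ∑ i, d i) := by
      split_ifs with hc
      · rw [kE, if_neg (by omega)]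
        simp
      · have he : n + 1 - 3 - ∑ i, d i = n - 3 - ∑ i, d i + 1 := by omega
        rw [kE, if_pos (by omega), he, Nat.add_sub_cancel, pow_succ]
        ring
    rw [Finset.sum_congr rfl fun i _ => hterm i, hlast, kE, hs, if_pos h,
      Nat.multinomial_univ_snoc_snoc_zero, Nat.multinomial_univ_snoc_eq_sum _ _ (by omega),
      ← Finset.sum_mul, ← add_mul, Nat.cast_add, Nat.cast_sum]
  · rw [kE, hs, if_neg h, kE, if_neg (by omega), mul_zero, zero_add, eq_comm]
    refine Finset.sum_eq_zero fun i _ => ?_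
    split_ifs with hi
    · rfl
    · have hu := sum_update_pred d i hi
      rw [kE, if_neg (by omega)]
end

section
/- Any two solutions I, I′ of the string recursion (in the sense defined in the context, with the same fixed data p, (c_j), (b_{ij})) satisfying I(3,(0,0,0)) = I′(3,(0,0,0)) agree identically: I(n,d) = I′(n,d) for all n ≥ 3 and all d ∈ ℕⁿ. (This is the abstract form of the statement that the cobordism-valued string equation, together with the initial condition ∫_{M̄_{0,3}} 1 = 1, uniquely determines all psi-class intersections ∫_{M̄_{0,n}} ψ^d.) -/
/-- A family `I`, assigning to each `n ≥ 3` and each `d ∈ ℕⁿ` an element `I n d` of a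
commutative ring `L`, is a *solution of the string recursion* with data `p ∈ L`,
`(c j)_{j ≥ 0}`, `(b i j)_{i,j ≥ 0}` if:

(i) symmetry: `I n (d ∘ σ) = I n d` for every permutation `σ` of `Fin n`;

(ii) vanishing: `I n d = 0` whenever `d₁ + ⋯ + d_n > n - 3`;

(iii) for every `n ≥ 3` and `d ∈ ℕⁿ`,
`I (n+1) (d₁,…,d_n,0) = p·I n d − Σ_{i} Σ_{j ≥ 0} c j · I n (d - eᵢ + j·eᵢ)
  + Σ_T Σ_{i,j ≥ 0} b i j · I (|T|+1) (d|_T, i) · I (|T^c|+1) (d|_{T^c}, j)`,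
where summands with `dᵢ = 0` in the first sum read as `0`, `T` ranges over the subsets of
`{1,…,n}` with `|T| ≥ 2`, `|T^c| ≥ 2` and `|T ∩ {1,2,3}| ≤ 1`, `(d|_T, i)` is the tuple of
the entries `d_ℓ` for `ℓ ∈ T` in increasing order followed by `i`, and the sums over `j`
(resp. over `i` and `j`) are finite sums (`∑ᶠ`) since all but finitely many summands
vanish by (ii). -/
def IsStringSolution (L : Type*) [CommRing L] (p : L) (c : ℕ → L) (b : ℕ → ℕ → L)
    (I : (n : ℕ) → (Fin n → ℕ) → L) : Prop :=
  (∀ n : ℕ, 3 ≤ n → ∀ d : Fin n → ℕ, ∀ σ : Equiv.Perm (Fin n), I n (d ∘ σ) = I n d) ∧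
  (∀ n : ℕ, 3 ≤ n → ∀ d : Fin n → ℕ, n - 3 < ∑ i, d i → I n d = 0) ∧
  (∀ n : ℕ, (hn : 3 ≤ n) → ∀ d : Fin n → ℕ,
    I (n + 1) (Fin.snoc d 0) =
      p * I n d
      - (∑ i : Fin n, if d i = 0 then 0 else
          ∑ᶠ j : ℕ, c j * I n (Function.update d i (d i - 1 + j)))
      + ∑ T ∈ Finset.univ.powerset.filter (fun T : Finset (Fin n) =>
            2 ≤ T.card ∧ 2 ≤ Tᶜ.card ∧
            (T ∩ ({⟨0, by omega⟩, ⟨1, by omega⟩, ⟨2, by omega⟩} : Finset (Fin n))).card ≤ 1),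
          ∑ᶠ i : ℕ, ∑ᶠ j : ℕ,
            b i j * I (T.card + 1) (Fin.snoc (fun k => d (T.orderEmbOfFin rfl k)) i)
              * I (Tᶜ.card + 1) (Fin.snoc (fun k => d (Tᶜ.orderEmbOfFin rfl k)) j))

/-- Any two solutions of the string recursion (with the same data `p`, `(c j)`, `(b i j)`)
that agree at `n = 3`, `d = (0,0,0)` agree identically: the cobordism-valued string
equation together with the initial condition `∫_{M̄_{0,3}} 1 = 1` uniquely determines all
psi-class intersections. -/
theorem string_recursion_unique {L : Type*} [CommRing L] (p : L) (c : ℕ → L)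
    (b : ℕ → ℕ → L) (I I' : (n : ℕ) → (Fin n → ℕ) → L)
    (hI : IsStringSolution L p c b I) (hI' : IsStringSolution L p c b I')
    (h3 : I 3 (fun _ => 0) = I' 3 (fun _ => 0)) :
    ∀ n : ℕ, 3 ≤ n → ∀ d : Fin n → ℕ, I n d = I' n d := by
  intro n
  induction n using Nat.strong_induction_on with
  | _ n ih =>
  intro hn d
  by_cases hd : n - 3 < ∑ i, d i
  · rw [hI.2.1 n hn d hd, hI'.2.1 n hn d hd]
  obtain ⟨k, hk⟩ : ∃ k, d k = 0 := by
    by_contra! h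
    have hle : ∑ _i : Fin n, 1 ≤ ∑ i, d i :=
      Finset.sum_le_sum fun i _ => Nat.one_le_iff_ne_zero.mpr (h i)
    simp only [Finset.sum_const, Finset.card_univ, Fintype.card_fin, smul_eq_mul] at hle
    omega
  obtain rfl | ⟨m, rfl, hm⟩ : n = 3 ∨ ∃ m, n = m + 1 ∧ 3 ≤ m := by
    rcases hn.eq_or_lt with h | h
    · exact Or.inl h.symm
    · exact Or.inr ⟨n - 1, by omega, by omega⟩
  · have hzero : d = fun _ => 0 := by
      have hsum : ∑ i, d i = 0 := by omega
      exact funext fun i => Finset.sum_eq_zero_iff.mp hsum i (Finset.mem_univ i)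
    rw [hzero, h3]
  obtain ⟨e, he⟩ : ∃ e : Fin m → ℕ, d ∘ Equiv.swap k (Fin.last m) = Fin.snoc e 0 := by
    refine ⟨Fin.init (d ∘ Equiv.swap k (Fin.last m)), ?_⟩
    conv_lhs => rw [← Fin.snoc_init_self (d ∘ Equiv.swap k (Fin.last m))]
    simp [hk]
  rw [← hI.1 _ hn d (Equiv.swap k (Fin.last m)), ← hI'.1 _ hn d (Equiv.swap k (Fin.last m)), he,
    hI.2.2 m hm e, hI'.2.2 m hm e]
  have ihm : ∀ d, I m d = I' m d := ih m (Nat.lt_succ_self m) hm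
  simp only [ihm]
  congr 1
  refine Finset.sum_congr rfl fun T hT => ?_
  obtain ⟨-, hT₂, hTc₂, -⟩ := Finset.mem_filter.mp hT
  have hcard : T.card + Tᶜ.card = m := by simp
  have ihT : ∀ d, I (T.card + 1) d = I' (T.card + 1) d := ih _ (by omega) (by omega)
  have ihTc : ∀ d, I (Tᶜ.card + 1) d = I' (Tᶜ.card + 1) d := ih _ (by omega) (by omega)
  simp only [ihT, ihTc]
end
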